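/- arXiv:1912.05256 — 3 statements merged into one kernel-verified Lean document; each statement's English description precedes it below -/
import Mathlib

section
/- There exists a nonzero homogeneous polynomial g in k[X₁₁,X₁₂,X₂₁,X₂₂] such that for every x = (x₁₁,x₁₂,x₂₁,x₂₂) ∈ k⁴ with g(x) ≠ 0, the algebra S_x has k-dimension 18 and is isomorphic as a k-algebra to the direct product of nine copies of k with the matrix algebra M₃(k), i.e. S_x ≅ k^⊕9 × M₃(k). -/
open scoped TensorProduct

/-- A two-element family of types, used to form binary free products. -/
def fam (A B : Type) : Bool → Type
  | true => A
  | false => B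

instance famSemiring (A B : Type) [Semiring A] [Semiring B] : ∀ b, Semiring (fam A B b)
  | true => ‹Semiring A›
  | false => ‹Semiring B›

instance famAlgebra (k A B : Type) [CommSemiring k] [Semiring A] [Semiring B]
    [Algebra k A] [Algebra k B] : ∀ b, Algebra k (fam A B b)
  | true => ‹Algebra k A›
  | false => ‹Algebra k B›

/-- The free product (coproduct in the category of unital associative `k`-algebras)
`A * B` of two `k`-algebras. -/
abbrev FP (k A B : Type) [CommSemiring k] [Semiring A] [Semiring B]
    [Algebra k A] [Algebra k B] : Type :=
  LinearAlgebra.FreeProduct k (fam A B)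

/-- The canonical map `A →ₐ[k] A * B`. -/
noncomputable def inl (k A B : Type) [CommSemiring k] [Semiring A] [Semiring B]
    [Algebra k A] [Algebra k B] : A →ₐ[k] FP k A B :=
  LinearAlgebra.FreeProduct.ι k (fam A B) true

/-- The canonical map `B →ₐ[k] A * B`. -/
noncomputable def inr (k A B : Type) [CommSemiring k] [Semiring A] [Semiring B]
    [Algebra k A] [Algebra k B] : B →ₐ[k] FP k A B :=
  LinearAlgebra.FreeProduct.ι k (fam A B) false

/-- The image in `A*B` of the `i`-th standard primitive idempotent of `A = k^⊕3`. -/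
noncomputable def pgen (k : Type) [Field k] (i : Fin 3) : FP k (Fin 3 → k) (Fin 3 → k) :=
  inl k (Fin 3 → k) (Fin 3 → k) (Pi.single i 1)

/-- The image in `A*B` of the `i`-th standard primitive idempotent of `B = k^⊕3`. -/
noncomputable def qgen (k : Type) [Field k] (i : Fin 3) : FP k (Fin 3 → k) (Fin 3 → k) :=
  inr k (Fin 3 → k) (Fin 3 → k) (Pi.single i 1)

/-- The relator `∑ xᵢⱼ [pᵢ, qⱼ]` for `x ∈ k⁴`. -/
noncomputable def relator (k : Type) [Field k] (x : Fin 2 × Fin 2 → k) :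
    FP k (Fin 3 → k) (Fin 3 → k) :=
  ∑ ij : Fin 2 × Fin 2, x ij •
    (pgen k ij.1.castSucc * qgen k ij.2.castSucc
      - qgen k ij.2.castSucc * pgen k ij.1.castSucc)

/-- The algebra `S_x`: the quotient of `k^⊕3 * k^⊕3` by the two-sided ideal generated by
`∑ xᵢⱼ [pᵢ, qⱼ]`. -/
abbrev Sx (k : Type) [Field k] (x : Fin 2 × Fin 2 → k) : Type :=
  RingQuot (fun u v => u = relator k x ∧ v = 0)

/-- The sum over `Fin 3` written along any enumeration of its elements. -/
theorem sum_fin_three_of_ne {M : Type*} [AddCommMonoid M] (f : Fin 3 → M) {a b c : Fin 3}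
    (hab : a ≠ b) (hbc : b ≠ c) (hac : a ≠ c) : ∑ d, f d = f a + f b + f c := by
  have h : (Finset.univ : Finset (Fin 3)) = {a, b, c} := by
    revert a b c; decide
  rw [h, Finset.sum_insert (by simp [hab, hac]), Finset.sum_insert (by simp [hbc]),
    Finset.sum_singleton, add_assoc]

/-- The index in `Fin 3` different from two distinct given ones. -/
theorem neg_add_ne {a b : Fin 3} (h : a ≠ b) : b ≠ -(a + b) ∧ a ≠ -(a + b) := by
  revert a b; decide

theorem eq_neg_add {a b c : Fin 3} (hab : a ≠ b) (hbc : b ≠ c) (hac : a ≠ c) : c = -(a + b) := by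
  revert a b c; decide

theorem exists_third {a b : Fin 3} (h : a ≠ b) : ∃ c, b ≠ c ∧ a ≠ c :=
  ⟨_, neg_add_ne h⟩

/-- A `3 × 3` array with zero row and column sums, nonzero entries, and nonzero
(up to sign common) `2 × 2` minors `δ`. -/
structure IsGenericArray {k : Type*} [Field k] (D : Fin 3 → Fin 3 → k) (δ : k) : Prop where
  sum_row : ∀ a, ∑ j, D a j = 0
  sum_col : ∀ j, ∑ a, D a j = 0
  ne_zero : ∀ a j, D a j ≠ 0
  minor : ∀ a b, a ≠ b → (D a 1 * D b 0 - D a 0 * D b 1) ^ 2 = δ ^ 2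
  minor_ne_zero : δ ≠ 0

/-- Two complete systems of orthogonal idempotents `p`, `q` such that the off-diagonal Peirce
components of the `q j` with respect to `p` are proportional to the entries of `D`. -/
structure IsPeircePair {k S : Type*} [Field k] [Ring S] [Algebra k S] (D : Fin 3 → Fin 3 → k)
    (p q : Fin 3 → S) : Prop where
  left : CompleteOrthogonalIdempotents p
  right : CompleteOrthogonalIdempotents q
  proportional : ∀ a b c, a ≠ b → b ≠ c → a ≠ c → ∀ j,
    D c 0 • (p a * q j * p b) = D c j • (p a * q 0 * p b)

namespace IsPeircePair

variable {k S : Type*} [Field k] [Ring S] [Algebra k S] {D : Fin 3 → Fin 3 → k} {δ : k}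
  {p q : Fin 3 → S}

/-- The off-diagonal candidates for matrix units. -/
noncomputable def offUnit (D : Fin 3 → Fin 3 → k) (δ : k) (p q : Fin 3 → S) (a b : Fin 3) : S :=
  (δ ^ 2 / ((∏ j, D a j) * D (-(a + b)) 0)) • (p a * q 0 * p b)

/-- The candidates for matrix units. -/
noncomputable def matUnit (D : Fin 3 → Fin 3 → k) (δ : k) (p q : Fin 3 → S) (a b : Fin 3) : S :=
  if a = b then offUnit D δ p q a (a + 1) * offUnit D δ p q (a + 1) a else offUnit D δ p q a b

theorem sum_peirce (h : IsPeircePair D p q) (a b : Fin 3) :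
    ∑ j, p a * q j * p b = p a * p b := by
  rw [← Finset.sum_mul, ← Finset.mul_sum, h.right.complete, mul_one]

theorem peirce_mul_peirce (h : IsPeircePair D p q) (a b c d i j : Fin 3) :
    (p a * q i * p b) * (p c * q j * p d) = if b = c then p a * q i * p b * q j * p d else 0 := by
  have : (p a * q i * p b) * (p c * q j * p d) = p a * q i * (p b * p c) * q j * p d := by
    simp only [mul_assoc]
  rw [this, h.left.mul_eq]
  split_ifs <;> simp

theorem sum_peirce_mul_peirce (h : IsPeircePair D p q) (a b i j : Fin 3) :
    ∑ d, (p a * q i * p d) * (p d * q j * p b) = if i = j then p a * q i * p b else 0 := by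
  simp only [h.peirce_mul_peirce, if_true]
  rw [← Finset.sum_mul, ← Finset.sum_mul, ← Finset.mul_sum, h.left.complete, mul_one,
    mul_assoc (p a), h.right.mul_eq]
  split_ifs <;> simp

theorem peirce_eq_smul_offUnit (hD : IsGenericArray D δ) (h : IsPeircePair D p q) {a b c : Fin 3}
    (hab : a ≠ b) (hbc : b ≠ c) (hac : a ≠ c) (j : Fin 3) :
    p a * q j * p b = ((∏ i, D a i) * D c j / δ ^ 2) • offUnit D δ p q a b := by
  have hR : ∏ i, D a i ≠ 0 := Finset.prod_ne_zero_iff.2 fun i _ => hD.ne_zero a i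
  have hc := hD.ne_zero c 0
  have hd := hD.minor_ne_zero
  rw [offUnit, ← eq_neg_add hab hbc hac, smul_smul,
    show (∏ i, D a i) * D c j / δ ^ 2 * (δ ^ 2 / ((∏ i, D a i) * D c 0)) = (D c 0)⁻¹ * D c j by
      field_simp, mul_smul, ← h.proportional a b c hab hbc hac j, inv_smul_smul₀ hc]

theorem offUnit_mul (h : IsPeircePair D p q) (a b : Fin 3) :
    offUnit D δ p q a b * p b = offUnit D δ p q a b := by
  rw [offUnit, smul_mul_assoc, mul_assoc, (h.left.idem b).eq]

theorem mul_offUnit (h : IsPeircePair D p q) (a b : Fin 3) :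
    p a * offUnit D δ p q a b = offUnit D δ p q a b := by
  rw [offUnit, mul_smul_comm, mul_assoc, ← mul_assoc (p a) (p a), (h.left.idem a).eq]

theorem offUnit_mul_offUnit (hD : IsGenericArray D δ) (h : IsPeircePair D p q) {a b c : Fin 3}
    (hab : a ≠ b) (hbc : b ≠ c) (hac : a ≠ c) :
    offUnit D δ p q a c * offUnit D δ p q c b = offUnit D δ p q a b := by
  have key := fun i j => (sum_fin_three_of_ne _ hab hbc hac).symm.trans
    (h.sum_peirce_mul_peirce a b i j)
  simp only [h.peirce_eq_smul_offUnit hD hab hbc hac,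
    h.peirce_eq_smul_offUnit hD hac hbc.symm hab,
    h.peirce_eq_smul_offUnit hD hbc.symm hab.symm hac.symm, smul_mul_assoc, mul_smul_comm] at key
  have hm := hD.minor c b hbc.symm
  have hd := hD.minor_ne_zero
  have hr : D c 2 = - D c 0 - D c 1 := by
    have := hD.sum_row c; rw [Fin.sum_univ_three] at this; linear_combination this
  have hA : ∀ j, D a j = - D b j - D c j := fun j => by
    have := hD.sum_col j; rw [sum_fin_three_of_ne _ hab hbc hac] at this; linear_combination this
  have k00 := key 0 0
  have k11 := key 1 1
  have k01 := key 0 1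
  have k10 := key 1 0
  simp only [if_true, if_false, one_ne_zero, zero_ne_one] at k00 k11 k01 k10
  have hRa : ∏ i, D a i ≠ 0 := Finset.prod_ne_zero_iff.2 fun i _ => hD.ne_zero a i
  have hRc : ∏ i, D c i = D c 0 * D c 1 * (- D c 0 - D c 1) := by rw [Fin.prod_univ_three, hr]
  have c0 := hD.ne_zero c 0
  have c1 := hD.ne_zero c 1
  have c2 := hD.ne_zero c 2
  rw [hr] at c2
  have e : ((∏ i, D a i) * (∏ i, D c i) / δ ^ 2) •
      (offUnit D δ p q a c * offUnit D δ p q c b - offUnit D δ p q a b) = 0 := by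
    rw [hRc] at k00 k11 k01 k10 ⊢
    generalize offUnit D δ p q a c * offUnit D δ p q c b = z at *
    generalize offUnit D δ p q a b = y at *
    generalize ∏ i, D a i = r at *
    simp only [hA] at k00 k11 k01 k10
    have hd2 : δ ^ 2 ≠ 0 := pow_ne_zero 2 hd
    generalize δ ^ 2 = E at *
    linear_combination (norm := match_scalars) (-(D c 1) ^ 2 : k) • k00 - (D c 0 ^ 2 : k) • k11 +
      (D c 0 * D c 1 : k) • (k01 + k10)
    all_goals field_simp
    · linear_combination (-(r * D c 0 * D c 1 * (-D c 0 - D c 1))) * hm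
    all_goals ring
  have hne : (∏ i, D a i) * (∏ i, D c i) / δ ^ 2 ≠ 0 := by
    have : ∏ i, D c i ≠ 0 := Finset.prod_ne_zero_iff.2 fun i _ => hD.ne_zero c i
    positivity
  exact sub_eq_zero.1 ((smul_eq_zero_iff_right hne).1 e)

theorem offUnit_mul_offUnit_self (hD : IsGenericArray D δ) (h : IsPeircePair D p q) {a b : Fin 3}
    (hab : a ≠ b) : offUnit D δ p q a b * offUnit D δ p q b a = matUnit D δ p q a a := by
  have indep : ∀ {b c : Fin 3}, a ≠ b → b ≠ c → a ≠ c →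
      offUnit D δ p q a b * offUnit D δ p q b a = offUnit D δ p q a c * offUnit D δ p q c a := by
    intro b c hab hbc hac
    rw [← h.offUnit_mul_offUnit hD hab hbc hac, mul_assoc,
      h.offUnit_mul_offUnit hD hac.symm hab hbc.symm]
  rw [matUnit, if_pos rfl]
  obtain rfl | hb := eq_or_ne b (a + 1)
  · rfl
  · exact indep hab hb (by clear * -; revert a; decide)

theorem matUnit_of_ne {a b : Fin 3} (hab : a ≠ b) :
    matUnit D δ p q a b = offUnit D δ p q a b := if_neg hab

theorem matUnit_mul (h : IsPeircePair D p q) (a b : Fin 3) :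
    matUnit D δ p q a b * p b = matUnit D δ p q a b := by
  rw [matUnit]
  split_ifs with hab
  · rw [← hab, mul_assoc, h.offUnit_mul]
  · exact h.offUnit_mul a b

theorem mul_matUnit (h : IsPeircePair D p q) (a b : Fin 3) :
    p a * matUnit D δ p q a b = matUnit D δ p q a b := by
  rw [matUnit]
  split_ifs with hab
  · rw [← mul_assoc, h.mul_offUnit]
  · exact h.mul_offUnit a b

theorem matUnit_mul_matUnit_same (hD : IsGenericArray D δ) (h : IsPeircePair D p q)
    (a b c : Fin 3) :
    matUnit D δ p q a b * matUnit D δ p q b c = matUnit D δ p q a c := by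
  have left : ∀ {a b : Fin 3}, a ≠ b →
      matUnit D δ p q a a * offUnit D δ p q a b = offUnit D δ p q a b := by
    intro a b hab
    obtain ⟨c, hbc, hac⟩ := exists_third hab
    rw [← h.offUnit_mul_offUnit_self hD hac, mul_assoc,
      h.offUnit_mul_offUnit hD hbc.symm hab.symm hac.symm, h.offUnit_mul_offUnit hD hab hbc hac]
  have right : ∀ {a b : Fin 3}, a ≠ b →
      offUnit D δ p q a b * matUnit D δ p q b b = offUnit D δ p q a b := by
    intro a b hab
    obtain ⟨c, hbc, hac⟩ := exists_third hab
    rw [← h.offUnit_mul_offUnit_self hD hbc, ← mul_assoc,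
      h.offUnit_mul_offUnit hD hac hbc.symm hab, h.offUnit_mul_offUnit hD hab hbc hac]
  obtain rfl | hab := eq_or_ne a b
  · obtain rfl | hac := eq_or_ne a c
    · obtain ⟨b, hb⟩ := exists_ne a
      nth_rw 2 [← h.offUnit_mul_offUnit_self hD hb.symm]
      rw [← mul_assoc, left hb.symm, h.offUnit_mul_offUnit_self hD hb.symm]
    · rw [matUnit_of_ne hac, left hac]
  · obtain rfl | hbc := eq_or_ne b c
    · rw [matUnit_of_ne hab, right hab]
    · obtain rfl | hac := eq_or_ne a c
      · rw [matUnit_of_ne hab, matUnit_of_ne hbc, h.offUnit_mul_offUnit_self hD hab]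
      · rw [matUnit_of_ne hab, matUnit_of_ne hbc, matUnit_of_ne hac,
          h.offUnit_mul_offUnit hD hac hbc.symm hab]

theorem matUnit_mul_matUnit_of_ne (h : IsPeircePair D p q) (a d : Fin 3) {b c : Fin 3}
    (hbc : b ≠ c) : matUnit D δ p q a b * matUnit D δ p q c d = 0 := by
  rw [← h.matUnit_mul a b, ← h.mul_matUnit c d, mul_assoc, ← mul_assoc (p b), h.left.ortho hbc,
    zero_mul, mul_zero]

/-- The products of the diagonal Peirce components of the `q j`. -/
theorem exists_diag_mul_diag (hD : IsGenericArray D δ) (h : IsPeircePair D p q) (a i j : Fin 3) :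
    ∃ n : k, (p a * q i * p a) * (p a * q j * p a) =
      (if i = j then p a * q i * p a else 0) - n • matUnit D δ p q a a := by
  obtain ⟨b, hb⟩ := exists_ne a
  obtain ⟨c, hbc, hac⟩ := exists_third hb.symm
  have key := (sum_fin_three_of_ne _ hb.symm hbc hac).symm.trans (h.sum_peirce_mul_peirce a a i j)
  rw [h.peirce_eq_smul_offUnit hD hb.symm hbc hac, h.peirce_eq_smul_offUnit hD hac hbc.symm hb.symm,
    h.peirce_eq_smul_offUnit hD hb hac hbc, h.peirce_eq_smul_offUnit hD hac.symm hb.symm hbc.symm,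
    smul_mul_smul_comm, smul_mul_smul_comm, h.offUnit_mul_offUnit_self hD hb.symm,
    h.offUnit_mul_offUnit_self hD hac, add_assoc, ← add_smul] at key
  exact ⟨_, eq_sub_of_add_eq key⟩

theorem exists_diag_mul_diag_of_ne (hD : IsGenericArray D δ) (h : IsPeircePair D p q)
    (a : Fin 3) {i j : Fin 3} (hij : i ≠ j) :
    ∃ n : k, n ≠ 0 ∧ (p a * q i * p a) * (p a * q j * p a) = n • matUnit D δ p q a a ∧
      (p a * q j * p a) * (p a * q i * p a) = n • matUnit D δ p q a a := by
  obtain ⟨b, hb⟩ := exists_ne a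
  obtain ⟨c, hbc, hac⟩ := exists_third hb.symm
  obtain ⟨l, hjl, hil⟩ := exists_third hij
  have key := fun i j => (sum_fin_three_of_ne _ hb.symm hbc hac).symm.trans
    (h.sum_peirce_mul_peirce a a i j)
  simp only [h.peirce_eq_smul_offUnit hD hb.symm hbc hac,
    h.peirce_eq_smul_offUnit hD hac hbc.symm hb.symm,
    h.peirce_eq_smul_offUnit hD hb hac hbc, h.peirce_eq_smul_offUnit hD hac.symm hb.symm hbc.symm,
    smul_mul_smul_comm, smul_mul_smul_comm, h.offUnit_mul_offUnit_self hD hb.symm,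
    h.offUnit_mul_offUnit_self hD hac, add_assoc, ← add_smul] at key
  have kij := key i j
  have kji := key j i
  rw [if_neg hij] at kij
  rw [if_neg hij.symm] at kji
  have hA : D a l = - D b l - D c l := by
    have := hD.sum_col l; rw [sum_fin_three_of_ne _ hb.symm hbc hac] at this
    linear_combination this
  have ne := hD.ne_zero
  have hd := hD.minor_ne_zero
  have hR : ∀ d, ∏ m, D d m = D d i * D d j * D d l := by
    intro d
    have hu : (Finset.univ : Finset (Fin 3)) = {i, j, l} := by
      clear * - hij hjl hil; revert i j l; decide
    rw [hu, Finset.prod_insert (by simp [hij, hil]), Finset.prod_insert (by simp [hjl]),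
      Finset.prod_singleton, mul_assoc]
  refine ⟨(∏ m, D a m) * (D b i * D b j * D c i * D c j * D a l) / δ ^ 4, ?_, ?_, ?_⟩
  · rw [hR]
    simp [ne, hd]
  · rw [eq_neg_of_add_eq_zero_left kij, ← neg_smul]
    congr 1
    rw [hR b, hR c, hA]
    field_simp
    ring
  · rw [eq_neg_of_add_eq_zero_left kji, ← neg_smul]
    congr 1
    rw [hR b, hR c, hA]
    field_simp
    ring

theorem exists_diag_mul_matUnit (hD : IsGenericArray D δ) (h : IsPeircePair D p q) (a j : Fin 3) :
    ∃ r : k, (p a * q j * p a) * matUnit D δ p q a a = r • matUnit D δ p q a a ∧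
      matUnit D δ p q a a * (p a * q j * p a) = r • matUnit D δ p q a a := by
  set t : Fin 3 → S := fun j => p a * q j * p a with ht
  set e := matUnit D δ p q a a with he
  change ∃ r : k, t j * e = r • e ∧ e * t j = r • e
  have hcomm : ∀ i j, Commute (t i) (t j) := by
    intro i j
    obtain rfl | hij := eq_or_ne i j
    · exact Commute.refl _
    · obtain ⟨n, -, h1, h2⟩ := h.exists_diag_mul_diag_of_ne hD a hij
      exact h1.trans h2.symm
  have hsum : ∑ i, t i * e = e := by
    rw [← Finset.sum_mul, ht, h.sum_peirce, (h.left.idem a).eq, h.mul_matUnit]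
  have hte : ∀ i, Commute (t i) e := by
    intro i
    obtain ⟨n, hn, h1, -⟩ := h.exists_diag_mul_diag_of_ne hD a (show (0 : Fin 3) ≠ 1 by decide)
    rw [← inv_smul_smul₀ hn e, ← h1]
    exact ((hcomm i 0).mul_right (hcomm i 1)).smul_right _
  suffices ∃ r : k, t j * e = r • e by
    obtain ⟨r, hr⟩ := this
    exact ⟨r, hr, (hte j).eq.symm.trans hr⟩
  obtain ⟨i, hji, l, hil, hjl⟩ : ∃ i, j ≠ i ∧ ∃ l, i ≠ l ∧ j ≠ l := by
    clear * -; revert j; decide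
  obtain ⟨n, hn, h1, -⟩ := h.exists_diag_mul_diag_of_ne hD a hji
  obtain ⟨n', hn', h2, -⟩ := h.exists_diag_mul_diag_of_ne hD a hjl
  obtain ⟨m, -, h3, -⟩ := h.exists_diag_mul_diag_of_ne hD a hil
  change t j * t i = n • e at h1
  change t j * t l = n' • e at h2
  change t i * t l = m • e at h3
  have e1 : m • (t j * e) = n • (t l * e) := by
    rw [← mul_smul_comm, ← mul_smul_comm, ← h3, ← h1, ← mul_assoc, h1]
    exact ((hte l).smul_right n).eq.symm
  have e2 : m • (t j * e) = n' • (t i * e) := by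
    rw [← mul_smul_comm, ← mul_smul_comm, ← h3, ← h2, (hcomm j i).left_comm]
  have e3 : e = (1 + m / n' + m / n) • (t j * e) := by
    rw [sum_fin_three_of_ne _ hji hil hjl] at hsum
    rw [add_smul, add_smul, one_smul, div_eq_inv_mul, div_eq_inv_mul, mul_smul, mul_smul, e1,
      inv_smul_smul₀ hn, ← e1, e2, inv_smul_smul₀ hn', hsum]
  obtain h0 | h0 := eq_or_ne (1 + m / n' + m / n) 0
  · rw [h0, zero_smul] at e3
    exact ⟨0, by rw [e3, mul_zero, smul_zero]⟩
  · exact ⟨(1 + m / n' + m / n)⁻¹, (eq_inv_smul_iff₀ h0).2 e3.symm⟩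

/-- The eighteen elements spanning the algebra generated by a Peirce pair. -/
noncomputable def spanningFamily (D : Fin 3 → Fin 3 → k) (δ : k) (p q : Fin 3 → S) :
    (Fin 3 × Fin 3) ⊕ (Fin 3 × Fin 3) → S :=
  Sum.elim (fun ab => matUnit D δ p q ab.1 ab.2) (fun aj => p aj.1 * q aj.2 * p aj.1)

theorem matUnit_mem_span (a b : Fin 3) :
    matUnit D δ p q a b ∈ Submodule.span k (Set.range (spanningFamily D δ p q)) :=
  Submodule.subset_span ⟨Sum.inl (a, b), rfl⟩

theorem diag_mem_span (a j : Fin 3) :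
    p a * q j * p a ∈ Submodule.span k (Set.range (spanningFamily D δ p q)) :=
  Submodule.subset_span ⟨Sum.inr (a, j), rfl⟩

theorem matUnit_mul_mem_span (hD : IsGenericArray D δ) (h : IsPeircePair D p q) (a b : Fin 3)
    {s : S} (hs : s ∈ Submodule.span k (Set.range (spanningFamily D δ p q))) :
    matUnit D δ p q a b * s ∈ Submodule.span k (Set.range (spanningFamily D δ p q)) := by
  induction hs using Submodule.span_induction with
  | zero => rw [mul_zero]; exact zero_mem _
  | add x y _ _ hx hy => rw [mul_add]; exact add_mem hx hy
  | smul r x _ hx => rw [mul_smul_comm]; exact Submodule.smul_mem _ _ hx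
  | mem x hx =>
    obtain ⟨⟨c, d⟩ | ⟨c, j⟩, rfl⟩ := hx
    · obtain rfl | hbc := eq_or_ne b c
      · rw [spanningFamily, Sum.elim_inl, h.matUnit_mul_matUnit_same hD]
        exact matUnit_mem_span _ _
      · rw [spanningFamily, Sum.elim_inl, h.matUnit_mul_matUnit_of_ne _ _ hbc]
        exact zero_mem _
    · rw [spanningFamily, Sum.elim_inr]
      obtain rfl | hbc := eq_or_ne b c
      · obtain ⟨r, -, hr⟩ := h.exists_diag_mul_matUnit hD b j
        have e : matUnit D δ p q a b * (p b * q j * p b) = r • matUnit D δ p q a b := by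
          rw [← h.matUnit_mul_matUnit_same hD a b b, mul_assoc, hr, mul_smul_comm]
        rw [e]
        exact Submodule.smul_mem _ _ (matUnit_mem_span _ _)
      · rw [← h.matUnit_mul a b, mul_assoc, ← mul_assoc (p b), ← mul_assoc (p b),
          h.left.ortho hbc, zero_mul, zero_mul, mul_zero]
        exact zero_mem _

theorem diag_mul_mem_span (hD : IsGenericArray D δ) (h : IsPeircePair D p q) (a i : Fin 3)
    {s : S} (hs : s ∈ Submodule.span k (Set.range (spanningFamily D δ p q))) :
    p a * q i * p a * s ∈ Submodule.span k (Set.range (spanningFamily D δ p q)) := by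
  induction hs using Submodule.span_induction with
  | zero => rw [mul_zero]; exact zero_mem _
  | add x y _ _ hx hy => rw [mul_add]; exact add_mem hx hy
  | smul r x _ hx => rw [mul_smul_comm]; exact Submodule.smul_mem _ _ hx
  | mem x hx =>
    obtain ⟨⟨c, d⟩ | ⟨c, j⟩, rfl⟩ := hx
    · rw [spanningFamily, Sum.elim_inl]
      obtain rfl | hac := eq_or_ne a c
      · obtain ⟨r, hr, -⟩ := h.exists_diag_mul_matUnit hD a i
        have e : p a * q i * p a * matUnit D δ p q a d = r • matUnit D δ p q a d := by
          rw [← h.matUnit_mul_matUnit_same hD a a d, ← mul_assoc, hr, smul_mul_assoc]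
        rw [e]
        exact Submodule.smul_mem _ _ (matUnit_mem_span _ _)
      · rw [← h.mul_matUnit c d, ← mul_assoc, mul_assoc _ (p a), h.left.ortho hac, mul_zero,
          zero_mul]
        exact zero_mem _
    · rw [spanningFamily, Sum.elim_inr]
      obtain rfl | hac := eq_or_ne a c
      · obtain ⟨n, hn⟩ := h.exists_diag_mul_diag hD a i j
        rw [hn]
        refine sub_mem ?_ (Submodule.smul_mem _ _ (matUnit_mem_span _ _))
        split_ifs
        · exact diag_mem_span _ _
        · exact zero_mem _
      · rw [h.peirce_mul_peirce, if_neg hac]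
        exact zero_mem _

theorem span_eq_top (hD : IsGenericArray D δ) (h : IsPeircePair D p q)
    (hgen : Algebra.adjoin k (Set.range p ∪ Set.range q) = ⊤) :
    Submodule.span k (Set.range (spanningFamily D δ p q)) = ⊤ := by
  have hpsum : ∀ a, p a = ∑ j, p a * q j * p a := fun a => by
    rw [h.sum_peirce, (h.left.idem a).eq]
  have hqsum : ∀ j, q j = ∑ a, ∑ b, p a * q j * p b := fun j => by
    simp only [← Finset.mul_sum, h.left.complete, mul_one, ← Finset.sum_mul, one_mul]
  have hmul : ∀ x s : S, s ∈ Submodule.span k (Set.range (spanningFamily D δ p q)) →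
      x * s ∈ Submodule.span k (Set.range (spanningFamily D δ p q)) := by
    intro x
    have hx : x ∈ Algebra.adjoin k (Set.range p ∪ Set.range q) := hgen ▸ Algebra.mem_top
    induction hx using Algebra.adjoin_induction with
    | algebraMap r =>
      intro s hs
      rw [← Algebra.smul_def]
      exact Submodule.smul_mem _ _ hs
    | add x y _ _ hx hy => intro s hs; rw [add_mul]; exact add_mem (hx s hs) (hy s hs)
    | mul x y _ _ hx hy => intro s hs; rw [mul_assoc]; exact hx _ (hy s hs)
    | mem x hx =>
      intro s hs
      obtain ⟨a, rfl⟩ | ⟨j, rfl⟩ := hx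
      · rw [hpsum a, Finset.sum_mul]
        exact sum_mem fun j _ => h.diag_mul_mem_span hD a j hs
      · rw [hqsum j, Finset.sum_mul]
        refine sum_mem fun a _ => ?_
        rw [Finset.sum_mul]
        refine sum_mem fun b _ => ?_
        obtain rfl | hab := eq_or_ne a b
        · exact h.diag_mul_mem_span hD a j hs
        · obtain ⟨c, hbc, hac⟩ := exists_third hab
          rw [h.peirce_eq_smul_offUnit hD hab hbc hac, smul_mul_assoc, ← matUnit_of_ne hab]
          exact Submodule.smul_mem _ _ (h.matUnit_mul_mem_span hD a b hs)
  have hone : (1 : S) ∈ Submodule.span k (Set.range (spanningFamily D δ p q)) := by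
    rw [← h.left.complete]
    refine sum_mem fun a _ => ?_
    rw [hpsum a]
    exact sum_mem fun j _ => diag_mem_span a j
  exact (Submodule.eq_top_iff').2 fun x => mul_one x ▸ hmul x 1 hone

end IsPeircePair

/-- The cross products of the differences of the rows of `x`, extended by a zero row and a zero
column, with `(1, 1, 1)`. -/
def formArray {k : Type*} [Field k] (x : Fin 2 × Fin 2 → k) : Fin 3 → Fin 3 → k :=
  ![![-x (1, 1), x (1, 0), x (1, 1) - x (1, 0)],
    ![x (0, 1), -x (0, 0), x (0, 0) - x (0, 1)],
    ![x (1, 1) - x (0, 1), x (0, 0) - x (1, 0), x (0, 1) - x (1, 1) - x (0, 0) + x (1, 0)]]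

/-- The determinant of `x`. -/
def formDet {k : Type*} [Field k] (x : Fin 2 × Fin 2 → k) : k :=
  x (0, 0) * x (1, 1) - x (0, 1) * x (1, 0)

theorem isGenericArray_formArray {k : Type*} [Field k] {x : Fin 2 × Fin 2 → k}
    (h : ∀ a j, formArray x a j ≠ 0) (hdet : formDet x ≠ 0) :
    IsGenericArray (formArray x) (formDet x) where
  sum_row a := by
    rw [Fin.sum_univ_three]
    fin_cases a <;> simp [formArray] <;> ring
  sum_col j := by
    rw [Fin.sum_univ_three]
    fin_cases j <;> simp [formArray] <;> ring
  ne_zero := h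
  minor a b hab := by
    fin_cases a <;> fin_cases b <;> first | exact absurd rfl hab | skip
    all_goals simp [formArray, formDet] <;> ring
  minor_ne_zero := hdet

theorem isPeircePair_of_sum_commutator_eq_zero {k S : Type*} [Field k] [Ring S] [Algebra k S]
    {x : Fin 2 × Fin 2 → k} {p q : Fin 3 → S} (hp : CompleteOrthogonalIdempotents p)
    (hq : CompleteOrthogonalIdempotents q)
    (h : ∑ ij : Fin 2 × Fin 2, x ij •
      (p ij.1.castSucc * q ij.2.castSucc - q ij.2.castSucc * p ij.1.castSucc) = 0) :
    IsPeircePair (formArray x) p q where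
  left := hp
  right := hq
  proportional a b c hab hbc hac j := by
    have hcomm : ∀ i j, p a * (p i * q j - q j * p i) * p b =
        ((if a = i then 1 else 0) - (if i = b then 1 else 0) : k) • (p a * q j * p b) := by
      intro i j
      rw [mul_sub, sub_mul, ← mul_assoc, ← mul_assoc, mul_assoc _ (p i) (p b), hp.mul_eq, hp.mul_eq]
      split_ifs with h1 h2 h2 <;> simp [h1, h2]
    have hrel : ∑ ij : Fin 2 × Fin 2, (x ij * ((if a = ij.1.castSucc then 1 else 0) -
        (if ij.1.castSucc = b then 1 else 0))) • (p a * q ij.2.castSucc * p b) = 0 := by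
      simpa only [mul_zero, zero_mul, Finset.mul_sum, Finset.sum_mul, mul_smul_comm,
        smul_mul_assoc, hcomm, smul_smul] using congrArg (fun s => p a * s * p b) h
    have hsum : ∑ j, p a * q j * p b = 0 := by
      rw [← Finset.sum_mul, ← Finset.mul_sum, hq.complete, mul_one, hp.ortho hab]
    rw [eq_neg_add hab hbc hac]
    generalize hw : (fun j => p a * q j * p b) = w at *
    have hw' : ∀ j, p a * q j * p b = w j := fun j => congrFun hw j
    simp only [hw'] at *
    clear hcomm h hp hq hw hw' hbc hac
    rw [Fin.sum_univ_three] at hsum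
    rw [Fintype.sum_prod_type, Fin.sum_univ_two, Fin.sum_univ_two, Fin.sum_univ_two] at hrel
    have hw2 : w 2 = - w 0 - w 1 := by rw [← sub_eq_zero, ← hsum]; abel
    fin_cases a <;> fin_cases b <;> first | exact absurd rfl hab | skip
    all_goals
      simp at hrel
      fin_cases j <;> simp [formArray, hw2]
    all_goals first
      | linear_combination (norm := module) (-1 : k) • hrel
      | linear_combination (norm := module) (1 : k) • hrel

/-- The algebra homomorphism out of `k^ι` given by a complete system of orthogonal idempotents. -/
noncomputable def piAlgHom {ι k R : Type*} [Fintype ι] [DecidableEq ι] [Field k] [Ring R]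
    [Algebra k R] {e : ι → R} (he : CompleteOrthogonalIdempotents e) : (ι → k) →ₐ[k] R :=
  AlgHom.ofLinearMap (Fintype.linearCombination k e)
    (by simp [Fintype.linearCombination_apply, he.complete])
    (by
      intro f g
      simp [Fintype.linearCombination_apply, Finset.sum_mul_sum, smul_smul, mul_comm, he.mul_eq])

theorem piAlgHom_single {ι k R : Type*} [Fintype ι] [DecidableEq ι] [Field k] [Ring R]
    [Algebra k R] {e : ι → R} (he : CompleteOrthogonalIdempotents e) (i : ι) :
    piAlgHom (k := k) he (Pi.single i 1) = e i := by
  simp [piAlgHom, Fintype.linearCombination_apply_single]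

section Sx

variable {k : Type} [Field k]

theorem completeOrthogonalIdempotents_single (ι : Type*) [Fintype ι] [DecidableEq ι] :
    CompleteOrthogonalIdempotents fun i : ι => (Pi.single i 1 : ι → k) :=
  CompleteOrthogonalIdempotents.single fun _ => k

/-- The image of `pᵢ` in `S_x`. -/
noncomputable def sxP (x : Fin 2 × Fin 2 → k) (i : Fin 3) : Sx k x :=
  RingQuot.mkAlgHom k _ (pgen k i)

/-- The image of `qᵢ` in `S_x`. -/
noncomputable def sxQ (x : Fin 2 × Fin 2 → k) (i : Fin 3) : Sx k x :=
  RingQuot.mkAlgHom k _ (qgen k i)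

theorem completeOrthogonalIdempotents_sxP (x : Fin 2 × Fin 2 → k) :
    CompleteOrthogonalIdempotents (sxP x) :=
  (completeOrthogonalIdempotents_single (k := k) (Fin 3)).map
    ((RingQuot.mkAlgHom k _).comp (inl k (Fin 3 → k) (Fin 3 → k))).toRingHom

theorem completeOrthogonalIdempotents_sxQ (x : Fin 2 × Fin 2 → k) :
    CompleteOrthogonalIdempotents (sxQ x) :=
  (completeOrthogonalIdempotents_single (k := k) (Fin 3)).map
    ((RingQuot.mkAlgHom k _).comp (inr k (Fin 3 → k) (Fin 3 → k))).toRingHom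

theorem sum_commutator_sx (x : Fin 2 × Fin 2 → k) :
    ∑ ij : Fin 2 × Fin 2, x ij •
      (sxP x ij.1.castSucc * sxQ x ij.2.castSucc - sxQ x ij.2.castSucc * sxP x ij.1.castSucc) =
      0 := by
  have h : RingQuot.mkAlgHom k (fun u v => u = relator k x ∧ v = 0) (relator k x) =
      RingQuot.mkAlgHom k _ 0 := RingQuot.mkAlgHom_rel k ⟨rfl, rfl⟩
  rw [map_zero, relator, map_sum] at h
  simp only [map_smul, map_sub, map_mul] at h
  exact h

theorem adjoin_pgen_union_qgen :
    Algebra.adjoin k (Set.range (pgen k) ∪ Set.range (qgen k)) = ⊤ := by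
  set N := Algebra.adjoin k (Set.range (pgen k) ∪ Set.range (qgen k))
  have hp : ∀ f, inl k (Fin 3 → k) (Fin 3 → k) f ∈ N := by
    intro f
    rw [pi_eq_sum_univ' f, map_sum]
    refine sum_mem fun i _ => ?_
    rw [map_smul]
    exact N.smul_mem (Algebra.subset_adjoin (Or.inl ⟨i, rfl⟩)) _
  have hq : ∀ f, inr k (Fin 3 → k) (Fin 3 → k) f ∈ N := by
    intro f
    rw [pi_eq_sum_univ' f, map_sum]
    refine sum_mem fun i _ => ?_
    rw [map_smul]
    exact N.smul_mem (Algebra.subset_adjoin (Or.inr ⟨i, rfl⟩)) _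
  have hι : ∀ b a, LinearAlgebra.FreeProduct.ι k (fam (Fin 3 → k) (Fin 3 → k)) b a ∈ N := by
    rintro (_ | _) a
    · exact hq a
    · exact hp a
  let f := LinearAlgebra.FreeProduct.lift k (fam (Fin 3 → k) (Fin 3 → k))
    fun {b} => (LinearAlgebra.FreeProduct.ι k (fam (Fin 3 → k) (Fin 3 → k)) b).codRestrict N (hι b)
  have hf : N.val.comp f = AlgHom.id k _ := by
    rw [LinearAlgebra.FreeProduct.lift_unique k (fam (Fin 3 → k) (Fin 3 → k))
        (maps := fun {b} => LinearAlgebra.FreeProduct.ι k _ b) (N.val.comp f),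
      LinearAlgebra.FreeProduct.lift_unique k (fam (Fin 3 → k) (Fin 3 → k))
        (maps := fun {b} => LinearAlgebra.FreeProduct.ι k _ b) (AlgHom.id k _)]
    · intro b; rfl
    · intro b
      rw [AlgHom.comp_assoc, LinearAlgebra.FreeProduct.lift_comp_ι]
      rfl
  rw [eq_top_iff]
  intro s _
  have hs : (f s : FP k (Fin 3 → k) (Fin 3 → k)) = s := AlgHom.congr_fun hf s
  exact hs ▸ (f s).2

theorem adjoin_sxP_union_sxQ (x : Fin 2 × Fin 2 → k) :
    Algebra.adjoin k (Set.range (sxP x) ∪ Set.range (sxQ x)) = ⊤ := by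
  have h : Set.range (sxP x) ∪ Set.range (sxQ x) =
      Set.image (RingQuot.mkAlgHom k (fun u v => u = relator k x ∧ v = 0))
        (Set.range (pgen k) ∪ Set.range (qgen k)) := by
    rw [Set.image_union, ← Set.range_comp, ← Set.range_comp]
    rfl
  rw [h, ← AlgHom.map_adjoin, adjoin_pgen_union_qgen, Algebra.map_top, AlgHom.range_eq_top]
  exact RingQuot.mkAlgHom_surjective k _

/-- The universal property of `S_x`. -/
theorem exists_sx_algHom {x : Fin 2 × Fin 2 → k} {R : Type} [Ring R] [Algebra k R]
    {p q : Fin 3 → R} (hp : CompleteOrthogonalIdempotents p) (hq : CompleteOrthogonalIdempotents q)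
    (h : ∑ ij : Fin 2 × Fin 2, x ij •
      (p ij.1.castSucc * q ij.2.castSucc - q ij.2.castSucc * p ij.1.castSucc) = 0) :
    ∃ φ : Sx k x →ₐ[k] R, (∀ i, φ (sxP x i) = p i) ∧ ∀ i, φ (sxQ x i) = q i := by
  let maps : ∀ b, fam (Fin 3 → k) (Fin 3 → k) b →ₐ[k] R
    | true => piAlgHom hp
    | false => piAlgHom hq
  let f := LinearAlgebra.FreeProduct.lift k (fam (Fin 3 → k) (Fin 3 → k)) fun {b} => maps b
  have hf : ∀ b, f.comp (LinearAlgebra.FreeProduct.ι k _ b) = maps b := fun b =>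
    LinearAlgebra.FreeProduct.lift_comp_ι k _ fun {b} => maps b
  have hfp : ∀ i, f (pgen k i) = p i := fun i =>
    (AlgHom.congr_fun (hf true) _).trans (piAlgHom_single hp i)
  have hfq : ∀ i, f (qgen k i) = q i := fun i =>
    (AlgHom.congr_fun (hf false) _).trans (piAlgHom_single hq i)
  have hrel : ∀ ⦃u v⦄, (u = relator k x ∧ v = 0) → f u = f v := by
    rintro u v ⟨rfl, rfl⟩
    rw [map_zero, relator, map_sum, ← h]
    simp only [map_smul, map_sub, map_mul, hfp, hfq]
  refine ⟨RingQuot.liftAlgHom k ⟨f, hrel⟩, fun i => ?_, fun i => ?_⟩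
  · rw [sxP, RingQuot.liftAlgHom_mkAlgHom_apply, hfp]
  · rw [sxQ, RingQuot.liftAlgHom_mkAlgHom_apply, hfq]

end Sx

section Target

variable {k : Type} [Field k]

/-- The matrix whose columns span the images of the rank one idempotents `qⱼ`. -/
def colMatrix (x : Fin 2 × Fin 2 → k) : Matrix (Fin 3) (Fin 3) k :=
  Matrix.of fun a j => formArray x a (j + 1) * formArray x a (j + 2)

/-- The inverse of `colMatrix`. -/
def rowMatrix (x : Fin 2 × Fin 2 → k) : Matrix (Fin 3) (Fin 3) k :=
  Matrix.of fun j a => formArray x (a + 1) j * formArray x (a + 2) j / formDet x ^ 2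

theorem rowMatrix_mul_colMatrix {x : Fin 2 × Fin 2 → k} (hdet : formDet x ≠ 0) :
    rowMatrix x * colMatrix x = 1 := by
  ext i j
  rw [Matrix.mul_apply, Fin.sum_univ_three]
  simp only [rowMatrix, colMatrix, Matrix.of_apply]
  fin_cases i <;> fin_cases j <;> simp <;> field_simp <;> simp [formArray, formDet] <;>
    first | ring1 | exact Or.inr (by ring1)

theorem completeOrthogonalIdempotents_diagonal (k : Type*) [Field k] :
    CompleteOrthogonalIdempotents
      fun i : Fin 3 => (Matrix.diagonal (Pi.single i 1) : Matrix (Fin 3) (Fin 3) k) :=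
  (CompleteOrthogonalIdempotents.single fun _ : Fin 3 => k).map (Matrix.diagonalRingHom (Fin 3) k)

theorem CompleteOrthogonalIdempotents.conj {R ι : Type*} [Ring R] [Fintype ι] {e : ι → R}
    (he : CompleteOrthogonalIdempotents e) {u v : R} (huv : u * v = 1) (hvu : v * u = 1) :
    CompleteOrthogonalIdempotents fun i => u * e i * v := by
  refine CompleteOrthogonalIdempotents.iff_ortho_complete.2 ⟨fun i j hij => ?_, ?_⟩
  · have : (u * e i * v) * (u * e j * v) = u * e i * (v * u) * e j * v := by
      simp only [mul_assoc]
    change (u * e i * v) * (u * e j * v) = 0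
    rw [this, hvu, mul_one, mul_assoc u, he.ortho hij, mul_zero, zero_mul]
  · rw [← Finset.sum_mul, ← Finset.mul_sum, he.complete, mul_one, huv]

theorem CompleteOrthogonalIdempotents.prodMk {R T ι : Type*} [Ring R] [Ring T] [Fintype ι]
    {e : ι → R} {f : ι → T} (he : CompleteOrthogonalIdempotents e)
    (hf : CompleteOrthogonalIdempotents f) :
    CompleteOrthogonalIdempotents fun i => (e i, f i) := by
  refine CompleteOrthogonalIdempotents.iff_ortho_complete.2 ⟨fun i j hij => ?_, ?_⟩
  · exact Prod.ext (he.ortho hij) (hf.ortho hij)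
  · exact Prod.ext (by simp [Prod.fst_sum, he.complete]) (by simp [Prod.snd_sum, hf.complete])

theorem completeOrthogonalIdempotents_pullback {ι κ : Type*} [Fintype ι] [DecidableEq ι]
    (k : Type*) [Field k] (f : κ → ι) :
    CompleteOrthogonalIdempotents fun i : ι => (fun m => (Pi.single i 1 : ι → k) (f m) : κ → k) :=
  (CompleteOrthogonalIdempotents.single fun _ : ι => k).map
    (RingHom.pi fun m => Pi.evalRingHom (fun _ : ι => k) (f m))

/-- The image of `p₁, p₂, p₃` in `k⁹ × M₃(k)`. -/
def targetP (k : Type) [Field k] (i : Fin 3) :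
    (Fin 3 × Fin 3 → k) × Matrix (Fin 3) (Fin 3) k :=
  (fun m => (Pi.single i 1 : Fin 3 → k) m.1, Matrix.diagonal (Pi.single i 1))

/-- The image of `q₁, q₂, q₃` in `k⁹ × M₃(k)`. -/
def targetQ (x : Fin 2 × Fin 2 → k) (j : Fin 3) :
    (Fin 3 × Fin 3 → k) × Matrix (Fin 3) (Fin 3) k :=
  (fun m => (Pi.single j 1 : Fin 3 → k) m.2, colMatrix x * Matrix.diagonal (Pi.single j 1) * rowMatrix x)

theorem completeOrthogonalIdempotents_targetP :
    CompleteOrthogonalIdempotents (targetP k) :=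
  (completeOrthogonalIdempotents_pullback k Prod.fst).prodMk
    (completeOrthogonalIdempotents_diagonal k)

theorem completeOrthogonalIdempotents_targetQ {x : Fin 2 × Fin 2 → k} (hdet : formDet x ≠ 0) :
    CompleteOrthogonalIdempotents (targetQ x) :=
  (completeOrthogonalIdempotents_pullback k Prod.snd).prodMk
    ((completeOrthogonalIdempotents_diagonal k).conj
      (mul_eq_one_comm.1 (rowMatrix_mul_colMatrix hdet)) (rowMatrix_mul_colMatrix hdet))

theorem conj_diagonal_apply (x : Fin 2 × Fin 2 → k) (j a b : Fin 3) :
    (colMatrix x * (Matrix.diagonal (Pi.single j 1) : Matrix (Fin 3) (Fin 3) k) * rowMatrix x) a b =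
      colMatrix x a j * rowMatrix x j b := by
  rw [Matrix.mul_apply]
  simp [Matrix.mul_diagonal, Pi.single_apply]

theorem sum_commutator_target (x : Fin 2 × Fin 2 → k) :
    ∑ ij : Fin 2 × Fin 2, x ij •
      (targetP k ij.1.castSucc * targetQ x ij.2.castSucc -
        targetQ x ij.2.castSucc * targetP k ij.1.castSucc) = 0 := by
  refine Prod.ext ?_ ?_
  · rw [Prod.fst_sum]
    refine Finset.sum_eq_zero fun ij _ => ?_
    simp [mul_comm]
  · rw [Prod.snd_sum]
    ext a b
    simp only [Fintype.sum_prod_type, Fin.sum_univ_two, targetP, targetQ, Prod.smul_snd,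
      Prod.snd_sub, Prod.snd_mul, Matrix.add_apply, Matrix.smul_apply, Matrix.sub_apply,
      Matrix.diagonal_mul, Matrix.mul_diagonal, conj_diagonal_apply, Prod.snd_zero,
      Matrix.zero_apply, smul_eq_mul]
    simp only [colMatrix, rowMatrix, Matrix.of_apply]
    fin_cases a <;> fin_cases b <;> simp [formArray] <;> ring

theorem peirce_target (x : Fin 2 × Fin 2 → k) (a j b : Fin 3) :
    targetP k a * targetQ x j * targetP k b =
      (if a = b then Pi.single (a, j) 1 else 0,
        (colMatrix x a j * rowMatrix x j b) • Matrix.single a b 1) := by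
  refine Prod.ext ?_ ?_
  · ext ⟨c, d⟩
    by_cases hab : a = b
    · subst hab
      by_cases hc : c = a <;> by_cases hd : d = j <;>
        simp [targetP, targetQ, Pi.single_apply, hc, hd]
    · by_cases hc : c = a <;> simp [targetP, targetQ, Pi.single_apply, hc, hab]
  · ext c d
    simp only [targetP, targetQ, Prod.snd_mul, Matrix.diagonal_mul, Matrix.mul_diagonal,
      conj_diagonal_apply, Matrix.smul_apply, Matrix.single_apply, Pi.single_apply, smul_eq_mul]
    obtain rfl | hc := eq_or_ne a c <;> obtain rfl | hd := eq_or_ne b d <;> simp [*, Ne.symm]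

theorem eq_top_of_targetP_mem_of_targetQ_mem {x : Fin 2 × Fin 2 → k}
    (h : ∀ a j, formArray x a j ≠ 0) (hdet : formDet x ≠ 0)
    (T : Subalgebra k ((Fin 3 × Fin 3 → k) × Matrix (Fin 3) (Fin 3) k))
    (hP : ∀ i, targetP k i ∈ T) (hQ : ∀ i, targetQ x i ∈ T) : T = ⊤ := by
  have hmem : ∀ a j b, targetP k a * targetQ x j * targetP k b ∈ T := fun a j b =>
    T.mul_mem (T.mul_mem (hP a) (hQ j)) (hP b)
  have hoff : ∀ a b, a ≠ b →
      ((0, Matrix.single a b 1) : (Fin 3 × Fin 3 → k) × Matrix (Fin 3) (Fin 3) k) ∈ T := by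
    intro a b hab
    have hne : colMatrix x a 0 * rowMatrix x 0 b ≠ 0 := by
      simp [colMatrix, rowMatrix, h, hdet]
    have := T.smul_mem (hmem a 0 b) (colMatrix x a 0 * rowMatrix x 0 b)⁻¹
    rwa [peirce_target, if_neg hab, Prod.smul_mk, smul_zero, inv_smul_smul₀ hne] at this
  have hunit : ∀ a b,
      ((0, Matrix.single a b 1) : (Fin 3 × Fin 3 → k) × Matrix (Fin 3) (Fin 3) k) ∈ T := by
    intro a b
    obtain rfl | hab := eq_or_ne a b
    · obtain ⟨b, hb⟩ := exists_ne a
      simpa using T.mul_mem (hoff a b hb.symm) (hoff b a hb)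
    · exact hoff a b hab
  have hpi : ∀ a j,
      ((Pi.single (a, j) 1, 0) : (Fin 3 × Fin 3 → k) × Matrix (Fin 3) (Fin 3) k) ∈ T := by
    intro a j
    have := T.sub_mem (hmem a j a) (T.smul_mem (hunit a a) (colMatrix x a j * rowMatrix x j a))
    rwa [peirce_target, if_pos rfl, Prod.smul_mk, smul_zero, Prod.mk_sub_mk, sub_zero,
      sub_self] at this
  rw [eq_top_iff]
  rintro ⟨f, M⟩ -
  have hfM : (f, M) = ∑ m, f m • ((Pi.single m 1, 0) :
      (Fin 3 × Fin 3 → k) × Matrix (Fin 3) (Fin 3) k) +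
      ∑ a, ∑ b, M a b • ((0, Matrix.single a b 1) :
      (Fin 3 × Fin 3 → k) × Matrix (Fin 3) (Fin 3) k) := by
    refine Prod.ext ?_ ?_
    · simpa [Prod.fst_sum] using pi_eq_sum_univ' f
    · simpa [Prod.snd_sum] using Matrix.matrix_eq_sum_single M
  rw [hfM]
  exact add_mem (sum_mem fun m _ => T.smul_mem (hpi m.1 m.2) _)
    (sum_mem fun a _ => sum_mem fun b _ => T.smul_mem (hunit a b) _)

end Target

/-- The product of the entries of `formArray` and `formDet`, as a polynomial. -/
noncomputable def genericPoly (k : Type*) [Field k] : MvPolynomial (Fin 2 × Fin 2) k :=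
  .X (0, 0) * .X (0, 1) * .X (1, 0) * .X (1, 1) * (.X (0, 0) - .X (0, 1)) *
    (.X (1, 1) - .X (1, 0)) * (.X (1, 1) - .X (0, 1)) * (.X (0, 0) - .X (1, 0)) *
    (.X (0, 1) - .X (1, 1) - .X (0, 0) + .X (1, 0)) *
    (.X (0, 0) * .X (1, 1) - .X (0, 1) * .X (1, 0))

theorem isHomogeneous_genericPoly (k : Type*) [Field k] : (genericPoly k).IsHomogeneous 11 := by
  have hX (i : Fin 2 × Fin 2) :
      (MvPolynomial.X i : MvPolynomial (Fin 2 × Fin 2) k).IsHomogeneous 1 :=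
    MvPolynomial.isHomogeneous_X k i
  exact (((((((((hX _).mul (hX _)).mul (hX _)).mul (hX _)).mul ((hX _).sub (hX _))).mul
    ((hX _).sub (hX _))).mul ((hX _).sub (hX _))).mul ((hX _).sub (hX _))).mul
    ((((hX _).sub (hX _)).sub (hX _)).add (hX _))).mul
    (((hX _).mul (hX _)).sub ((hX _).mul (hX _)))

theorem genericPoly_ne_zero (k : Type*) [Field k] [CharZero k] : genericPoly k ≠ 0 := by
  intro h
  have := congrArg
    (MvPolynomial.eval fun ij => (![![1, 2], ![3, 5]] : Fin 2 → Fin 2 → k) ij.1 ij.2) h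
  simp [genericPoly] at this
  norm_num at this

theorem formArray_ne_zero_of_eval_ne_zero {k : Type*} [Field k] {x : Fin 2 × Fin 2 → k}
    (h : MvPolynomial.eval x (genericPoly k) ≠ 0) (a j : Fin 3) : formArray x a j ≠ 0 := by
  simp only [genericPoly, map_mul, map_sub, map_add, MvPolynomial.eval_X, mul_ne_zero_iff] at h
  fin_cases a <;> fin_cases j <;> simp [formArray, h]

theorem formDet_ne_zero_of_eval_ne_zero {k : Type*} [Field k] {x : Fin 2 × Fin 2 → k}
    (h : MvPolynomial.eval x (genericPoly k) ≠ 0) : formDet x ≠ 0 := by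
  simp only [genericPoly, map_mul, map_sub, map_add, MvPolynomial.eval_X, mul_ne_zero_iff] at h
  exact h.2

theorem finrank_target (k : Type*) [Field k] :
    Module.finrank k ((Fin 3 × Fin 3 → k) × Matrix (Fin 3) (Fin 3) k) = 18 := by
  simp [Module.finrank_matrix]

theorem nonempty_sx_algEquiv {k : Type} [Field k] {x : Fin 2 × Fin 2 → k}
    (h : ∀ a j, formArray x a j ≠ 0) (hdet : formDet x ≠ 0) :
    Nonempty (Sx k x ≃ₐ[k] ((Fin 3 × Fin 3 → k) × Matrix (Fin 3) (Fin 3) k)) := by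
  obtain ⟨φ, hφp, hφq⟩ := exists_sx_algHom completeOrthogonalIdempotents_targetP
    (completeOrthogonalIdempotents_targetQ hdet) (sum_commutator_target x)
  have hsurj : Function.Surjective φ := AlgHom.range_eq_top φ |>.1 <|
    eq_top_of_targetP_mem_of_targetQ_mem h hdet φ.range (fun i => ⟨_, hφp i⟩) fun i => ⟨_, hφq i⟩
  have hpq : IsPeircePair (formArray x) (sxP x) (sxQ x) :=
    isPeircePair_of_sum_commutator_eq_zero (completeOrthogonalIdempotents_sxP x)
      (completeOrthogonalIdempotents_sxQ x) (sum_commutator_sx x)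
  have hspan := hpq.span_eq_top (isGenericArray_formArray h hdet)
    (by with_reducible_and_instances exact adjoin_sxP_union_sxQ x)
  have : Module.Finite k (Sx k x) := ⟨by
    rw [← hspan]
    exact Submodule.fg_span (Set.finite_range _)⟩
  have hle : Module.finrank k (Sx k x) ≤ 18 := by
    rw [← finrank_top, ← hspan]
    exact (finrank_range_le_card _).trans (by simp)
  have hge := LinearMap.finrank_le_finrank_of_surjective (f := φ.toLinearMap) hsurj
  rw [finrank_target] at hge
  have hinj : Function.Injective φ :=
    (LinearMap.injective_iff_surjective_of_finrank_eq_finrank (V := Sx k x)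
      (V₂ := (Fin 3 × Fin 3 → k) × Matrix (Fin 3) (Fin 3) k) (f := φ.toLinearMap)
      (by rw [hle.antisymm hge, finrank_target])).2 hsurj
  exact ⟨AlgEquiv.ofBijective φ ⟨hinj, hsurj⟩⟩

theorem statement0 (k : Type) [Field k] [IsAlgClosed k] [CharZero k] :
    ∃ (g : MvPolynomial (Fin 2 × Fin 2) k) (n : ℕ), g ≠ 0 ∧ g.IsHomogeneous n ∧
      ∀ x : Fin 2 × Fin 2 → k, MvPolynomial.eval x g ≠ 0 →
        Module.finrank k (Sx k x) = 18 ∧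
        Nonempty (Sx k x ≃ₐ[k] ((Fin 9 → k) × Matrix (Fin 3) (Fin 3) k)) := by
  refine ⟨genericPoly k, 11, genericPoly_ne_zero k, isHomogeneous_genericPoly k, fun x hx => ?_⟩
  obtain ⟨e⟩ := nonempty_sx_algEquiv (formArray_ne_zero_of_eval_ne_zero hx)
    (formDet_ne_zero_of_eval_ne_zero hx)
  refine ⟨e.toLinearEquiv.finrank_eq.trans (finrank_target k), ⟨e.trans ?_⟩⟩
  exact AlgEquiv.prodCongr (AlgEquiv.piCongrLeft k (fun _ : Fin 9 => k) finProdFinEquiv)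
    AlgEquiv.refl
end

section
/- Let s ≥ 3 and l ≥ 2 be integers. The algebra k^⊕s * k^⊕l has finite-dimensional irreducible representations of arbitrarily large dimension: for every natural number n there exists a simple left module over k^⊕s * k^⊕l whose k-dimension is finite and greater than n. -/
open scoped TensorProduct

/-- The diagonal operator on `Fin (n + 1) → k` with eigenvalues `1, …, n + 1`. -/
def diagOp (k : Type) [Field k] (n : ℕ) : Module.End k (Fin (n + 1) → k) where
  toFun u i := ((i : ℕ) + 1 : k) * u i
  map_add' u v := by ext i; simp [mul_add]
  map_smul' c u := by ext i; simp [mul_left_comm]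

/-- The cyclic shift on `Fin (n + 1) → k`. -/
def shiftOp (k : Type) [Field k] (n : ℕ) : Module.End k (Fin (n + 1) → k) where
  toFun u i := u (i + 1)
  map_add' _ _ := rfl
  map_smul' _ _ := rfl

theorem diagOp_surjective (k : Type) [Field k] [CharZero k] (n : ℕ) :
    Function.Surjective (diagOp k n) := by
  intro u
  refine ⟨fun i => ((i : ℕ) + 1 : k)⁻¹ * u i, ?_⟩
  ext i
  have : ((i : ℕ) + 1 : k) ≠ 0 := Nat.cast_add_one_ne_zero _
  simp [diagOp, this]

theorem shiftOp_surjective (k : Type) [Field k] (n : ℕ) :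
    Function.Surjective (shiftOp k n) := by
  intro u
  refine ⟨fun i => u (i - 1), ?_⟩
  ext i
  simp [shiftOp]

theorem Fin.ofNat_succ_eq_add_one (n m : ℕ) :
    Fin.ofNat (n + 1) (m + 1) = Fin.ofNat (n + 1) m + 1 := by
  ext
  simp [Fin.val_add]

theorem one_sub_diagOp_sub_shiftOp_surjective (k : Type) [Field k] (n : ℕ) :
    Function.Surjective (1 - diagOp k n - shiftOp k n : Module.End k (Fin (n + 1) → k)) := by
  rw [← LinearMap.injective_iff_surjective, injective_iff_map_eq_zero]
  intro u hu
  have h : ∀ i : Fin (n + 1), u (i + 1) = -((i : ℕ) : k) * u i := by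
    intro i
    have := congrFun hu i
    simp only [LinearMap.sub_apply, Module.End.one_apply, diagOp, shiftOp, LinearMap.coe_mk,
      AddHom.coe_mk, Pi.sub_apply, Pi.zero_apply] at this
    linear_combination -this
  have h' : ∀ m : ℕ, u (Fin.ofNat (n + 1) m + 1) = 0 := by
    intro m
    induction m with
    | zero => rw [h]; simp
    | succ m ih => rw [h, Fin.ofNat_succ_eq_add_one, ih, mul_zero]
  ext i
  have := h' ((i - 1 : Fin (n + 1)) : ℕ)
  simpa using this

theorem eval_mul_mem_of_diagOp_invariant {k : Type} [Field k] {n : ℕ}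
    {W : Submodule k (Fin (n + 1) → k)} (hD : ∀ u ∈ W, diagOp k n u ∈ W)
    (p : Polynomial k) : ∀ u ∈ W, (fun i : Fin (n + 1) => p.eval ((i : ℕ) + 1 : k) * u i) ∈ W := by
  induction p using Polynomial.induction_on' with
  | add p q hp hq =>
    intro u hu
    convert W.add_mem (hp u hu) (hq u hu) using 1
    ext i
    simp [add_mul]
  | monomial m a =>
    induction m with
    | zero =>
      intro u hu
      convert W.smul_mem a hu using 1
      ext i
      simp
    | succ m ih =>
      intro u hu
      convert ih _ (hD u hu) using 1
      ext i
      simp [diagOp, pow_succ, mul_assoc]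

/-- An operator algebra containing a diagonal operator with simple spectrum and its product with
the cyclic shift acts irreducibly. -/
theorem eq_top_of_diagOp_shiftOp_invariant {k : Type} [Field k] [CharZero k] {n : ℕ}
    {W : Submodule k (Fin (n + 1) → k)} (hD : ∀ u ∈ W, diagOp k n u ∈ W)
    (hS : ∀ u ∈ W, shiftOp k n (diagOp k n u) ∈ W) {u : Fin (n + 1) → k} (hu : u ∈ W)
    (hu0 : u ≠ 0) : W = ⊤ := by
  obtain ⟨i, hi⟩ := Function.ne_iff.mp hu0
  have hinj : Set.InjOn (fun j : Fin (n + 1) => ((j : ℕ) + 1 : k))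
      (Finset.univ : Finset (Fin (n + 1))) := by
    intro a _ b _ hab
    simpa [Fin.val_inj] using hab
  have hsingle : (Pi.single i 1 : Fin (n + 1) → k) ∈ W := by
    have := W.smul_mem (u i)⁻¹ (eval_mul_mem_of_diagOp_invariant hD
      (Lagrange.basis Finset.univ (fun j : Fin (n + 1) => ((j : ℕ) + 1 : k)) i) u hu)
    convert this using 1
    ext j
    rcases eq_or_ne j i with rfl | hj
    · have := Lagrange.eval_basis_self hinj (Finset.mem_univ j)
      have hi' : u j ≠ 0 := hi
      simp only [Pi.single_eq_same, Pi.smul_apply, smul_eq_mul]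
      rw [this, one_mul, inv_mul_cancel₀ hi']
    · have := Lagrange.eval_basis_of_ne
        (v := fun j : Fin (n + 1) => ((j : ℕ) + 1 : k)) hj.symm (Finset.mem_univ j)
      simp only [Pi.single_eq_of_ne hj, Pi.smul_apply, smul_eq_mul]
      rw [this, zero_mul, mul_zero]
  have hstep : ∀ j : Fin (n + 1), (Pi.single j 1 : Fin (n + 1) → k) ∈ W →
      (Pi.single (j - 1) 1 : Fin (n + 1) → k) ∈ W := by
    intro j hj
    have hne : ((j : ℕ) + 1 : k) ≠ 0 := Nat.cast_add_one_ne_zero _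
    convert W.smul_mem ((j : ℕ) + 1 : k)⁻¹ (hS _ hj) using 1
    ext t
    rcases eq_or_ne t (j - 1) with rfl | ht
    · simp [shiftOp, diagOp, hne]
    · have ht' : t + 1 ≠ j := fun h => ht (eq_sub_of_add_eq h)
      simp [shiftOp, diagOp, ht, ht']
  have hall : ∀ m : ℕ, (Pi.single (i - Fin.ofNat (n + 1) m) 1 : Fin (n + 1) → k) ∈ W := by
    intro m
    induction m with
    | zero => simpa using hsingle
    | succ m ih =>
      have := hstep _ ih
      rwa [sub_sub, ← Fin.ofNat_succ_eq_add_one] at this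
  have hj : ∀ j : Fin (n + 1), (Pi.single j 1 : Fin (n + 1) → k) ∈ W := by
    intro j
    have := hall ((i - j : Fin (n + 1)) : ℕ)
    simpa using this
  rw [eq_top_iff]
  intro v _
  rw [pi_eq_sum_univ' v]
  refine W.sum_mem fun j _ => W.smul_mem _ ?_
  convert hj j using 1

/-- The algebra `ι → k` acting on `ι → U` through the block-diagonal idempotents. -/
def blockDiagHom (k ι U : Type) [Field k] [AddCommGroup U] [Module k U] :
    (ι → k) →ₐ[k] Module.End k (ι → U) :=
  AlgHom.ofLinearMap
    { toFun := fun c =>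
        { toFun := fun m i => c i • m i
          map_add' := fun m m' => by ext i; simp
          map_smul' := fun a m => by ext i; simp [smul_comm a] }
      map_add' := fun c c' => by ext m i; simp [add_smul]
      map_smul' := fun a c => by ext m i; simp [mul_smul] }
    (by ext m i; simp)
    (fun c c' => by ext m i; simp [mul_smul])

/-- The homomorphism from `k × k` determined by an idempotent. -/
def idempotentHom {k E : Type} [Field k] [Ring E] [Algebra k E] {f : E}
    (hf : IsIdempotentElem f) : (Fin 2 → k) →ₐ[k] E :=
  AlgHom.ofLinearMap
    { toFun := fun c => c 0 • f + c 1 • (1 - f)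
      map_add' := fun c c' => by simp only [Pi.add_apply, add_smul]; abel
      map_smul' := fun a c => by simp [mul_smul] }
    (by simp)
    (fun c c' => by
      have h1 : f * (1 - f) = 0 := by rw [mul_sub, mul_one, hf.eq, sub_self]
      have h2 : (1 - f) * f = 0 := by rw [sub_mul, one_mul, hf.eq, sub_self]
      simp [mul_add, add_mul, hf.eq, hf.one_sub.eq, h1, h2, mul_smul, smul_comm (c' _)])

/-- Restriction of functions along `Fin a ⊆ Fin b`. -/
def restrictHom (k : Type) [Field k] {a b : ℕ} (h : a ≤ b) : (Fin b → k) →ₐ[k] (Fin a → k) :=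
  AlgHom.ofLinearMap (LinearMap.funLeft k k (Fin.castLE h)) rfl (fun _ _ => rfl)

theorem restrictHom_surjective (k : Type) [Field k] {a b : ℕ} (h : a ≤ b) :
    Function.Surjective (restrictHom k h) :=
  LinearMap.funLeft_surjective_of_injective k k _ (Fin.castLE_injective h)

/-- The universal property of the binary free product. -/
theorem exists_algHom_FP {k A B E : Type} [Field k] [Ring A] [Ring B] [Ring E] [Algebra k A]
    [Algebra k B] [Algebra k E] (α : A →ₐ[k] E) (β : B →ₐ[k] E) :
    ∃ φ : FP k A B →ₐ[k] E, (∀ a, φ (inl k A B a) = α a) ∧ ∀ b, φ (inr k A B b) = β b := by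
  let maps : {i : Bool} → fam A B i →ₐ[k] E := fun {i} =>
    match i with
    | true => α
    | false => β
  refine ⟨LinearAlgebra.FreeProduct.lift k (fam A B) maps, fun a => ?_, fun b => ?_⟩
  · exact DFunLike.congr_fun
      (LinearAlgebra.FreeProduct.lift_comp_ι k (fam A B) maps (i := true)) a
  · exact DFunLike.congr_fun
      (LinearAlgebra.FreeProduct.lift_comp_ι k (fam A B) maps (i := false)) b

/-- For `R + P + Q = 1`, the operator `(u₀, u₁, u₂) ↦ (x, P x, Q x)` with `x = R u₀ + u₁ + u₂`. -/
def graphOp {k U : Type} [Field k] [AddCommGroup U] [Module k U] (R P : Module.End k U) :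
    Module.End k (Fin 3 → U) :=
  LinearMap.pi ![1, P, 1 - R - P] ∘ₗ
    (R ∘ₗ LinearMap.proj (φ := fun _ : Fin 3 => U) 0 + LinearMap.proj 1 + LinearMap.proj 2)

theorem graphOp_isIdempotentElem {k U : Type} [Field k] [AddCommGroup U] [Module k U]
    (R P : Module.End k U) : IsIdempotentElem (graphOp R P) := by
  refine LinearMap.ext fun m => ?_
  simp only [graphOp, Module.End.mul_apply, LinearMap.comp_apply]
  congr 1
  simp
  abel

/-- Block subspaces stable under `graphOp R P` are controlled by the first block. -/
theorem eq_bot_or_eq_top_of_graphOp_invariant {k U : Type} [Field k] [AddCommGroup U] [Module k U]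
    {R P : Module.End k U} (hR : Function.Surjective R) (hP : Function.Surjective P)
    (hQ : Function.Surjective (1 - R - P : Module.End k U))
    (hU : ∀ W : Submodule k U, (∀ u ∈ W, R u ∈ W) → (∀ u ∈ W, P (R u) ∈ W) →
      ∀ u ∈ W, u ≠ 0 → W = ⊤)
    (W : Submodule k (Fin 3 → U)) (hW : ∀ m ∈ W, ∀ i, Pi.single i (m i) ∈ W)
    (hf : ∀ m ∈ W, graphOp R P m ∈ W) : W = ⊥ ∨ W = ⊤ := by
  have h0 : ∀ u, Pi.single 0 u ∈ W → Pi.single 0 (R u) ∈ W := fun u hu => by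
    simpa [graphOp] using hW _ (hf _ hu) 0
  have h1 : ∀ u, Pi.single 0 u ∈ W → Pi.single 1 (P (R u)) ∈ W := fun u hu => by
    simpa [graphOp] using hW _ (hf _ hu) 1
  have h2 : ∀ u, Pi.single 0 u ∈ W → Pi.single 2 ((1 - R - P) (R u)) ∈ W := fun u hu => by
    simpa [graphOp] using hW _ (hf _ hu) 2
  have h10 : ∀ u, Pi.single 1 u ∈ W → Pi.single 0 u ∈ W := fun u hu => by
    simpa [graphOp] using hW _ (hf _ hu) 0
  have h20 : ∀ u, Pi.single 2 u ∈ W → Pi.single 0 u ∈ W := fun u hu => by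
    simpa [graphOp] using hW _ (hf _ hu) 0
  rw [or_iff_not_imp_left]
  intro hne
  obtain ⟨m, hm, hm0⟩ := W.ne_bot_iff.mp hne
  obtain ⟨i, hi⟩ := Function.ne_iff.mp hm0
  have hmi : Pi.single 0 (m i) ∈ W := by
    have := hW m hm i
    fin_cases i
    exacts [this, h10 _ this, h20 _ this]
  have htop := hU (W.comap (LinearMap.single k (fun _ : Fin 3 => U) 0)) h0
    (fun u hu => h10 _ (h1 u hu)) (m i) hmi hi
  have hall0 : ∀ u, Pi.single 0 u ∈ W := fun u => by
    have : u ∈ W.comap (LinearMap.single k (fun _ : Fin 3 => U) 0) := htop ▸ Submodule.mem_top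
    exact this
  rw [eq_top_iff]
  intro v _
  rw [← Finset.univ_sum_single v]
  refine W.sum_mem fun j _ => ?_
  generalize v j = u
  fin_cases j
  · exact hall0 u
  · obtain ⟨v, rfl⟩ := hP u
    obtain ⟨w, rfl⟩ := hR v
    exact h1 w (hall0 w)
  · obtain ⟨v, rfl⟩ := hQ u
    obtain ⟨w, rfl⟩ := hR v
    exact h2 w (hall0 w)

theorem statement13 (k : Type) [Field k] [IsAlgClosed k] [CharZero k]
    (s l : ℕ) (hs : 3 ≤ s) (hl : 2 ≤ l) :
    ∀ n : ℕ, ∃ (M : Type) (_ : AddCommGroup M)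
      (_ : Module (FP k (Fin s → k) (Fin l → k)) M) (_ : Module k M)
      (_ : IsScalarTower k (FP k (Fin s → k) (Fin l → k)) M),
      IsSimpleModule (FP k (Fin s → k) (Fin l → k)) M ∧
      Module.Finite k M ∧ n < Module.finrank k M := by
  intro n
  have hidem := graphOp_isIdempotentElem (diagOp k n) (shiftOp k n)
  obtain ⟨φ, hφl, hφr⟩ := exists_algHom_FP
    ((blockDiagHom k (Fin 3) (Fin (n + 1) → k)).comp (restrictHom k hs))
    ((idempotentHom hidem).comp (restrictHom k hl))
  let _ : Module (FP k (Fin s → k) (Fin l → k)) (Fin 3 → Fin (n + 1) → k) :=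
    Module.compHom _ φ.toRingHom
  have hsmul : ∀ (a : FP k (Fin s → k) (Fin l → k)) (m : Fin 3 → Fin (n + 1) → k),
      a • m = φ a m := fun _ _ => rfl
  have htower : IsScalarTower k (FP k (Fin s → k) (Fin l → k)) (Fin 3 → Fin (n + 1) → k) :=
    ⟨fun c a m => by rw [hsmul, hsmul, map_smul, LinearMap.smul_apply]⟩
  refine ⟨Fin 3 → Fin (n + 1) → k, inferInstance, inferInstance, inferInstance, htower, ?_,
    inferInstance, ?_⟩
  · rw [isSimpleModule_iff]
    refine { eq_bot_or_eq_top := fun W => ?_ }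
    have h := eq_bot_or_eq_top_of_graphOp_invariant (diagOp_surjective k n)
      (shiftOp_surjective k n) (one_sub_diagOp_sub_shiftOp_surjective k n)
      (fun W hD hS u hu hu0 => eq_top_of_diagOp_shiftOp_invariant hD hS hu hu0)
      (W.restrictScalars k)
      (fun m hm i => by
        obtain ⟨a, ha⟩ := restrictHom_surjective k hs (Pi.single i 1)
        have := W.smul_mem (inl k _ _ a) hm
        rw [hsmul, hφl, AlgHom.comp_apply, ha] at this
        change Pi.single i (m i) ∈ W
        convert this using 1
        ext j t
        rcases eq_or_ne j i with rfl | hj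
        · simp [blockDiagHom]
        · simp [blockDiagHom, hj])
      (fun m hm => by
        obtain ⟨b, hb⟩ := restrictHom_surjective k hl (Pi.single 0 1)
        have := W.smul_mem (inr k _ _ b) hm
        rw [hsmul, hφr, AlgHom.comp_apply, hb] at this
        simpa [idempotentHom] using this)
    simpa using h
  · simp [Module.finrank_pi_fintype]
    omega
end

section
/- Let A and B be finite-dimensional unital associative k-algebras, let Ā be a k-linear complement of k·1 in A and B̄ a k-linear complement of k·1 in B, identified with their images in A*B (so that Ā ⊕ B̄ is a subspace of A*B). Let V ⊆ Ā ⊕ B̄ be a k-subspace such that the projections π_A : Ā ⊕ B̄ → Ā and π_B : Ā ⊕ B̄ → B̄ restrict to surjections of V onto Ā and onto B̄, and let R(V) denote the subalgebra of A*B generated by V. Put m = min(dim_k A, dim_k B). Then every simple left module over the quotient algebra (A*B)/⟨[R(V),R(V)]⟩ (the quotient of A*B by the two-sided ideal generated by all commutators of elements of R(V)) has finite k-dimension at most m. -/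
open scoped TensorProduct

/-- The relation whose induced quotient of `R` is the quotient by the two-sided ideal
generated by all commutators of elements of the subalgebra generated by `S`. -/
def commRel (k R : Type) [CommSemiring k] [Ring R] [Algebra k R] (S : Set R)
    (u v : R) : Prop :=
  (∃ a ∈ Algebra.adjoin k S, ∃ b ∈ Algebra.adjoin k S, u = a * b - b * a) ∧ v = 0

/-- If subalgebras `A`, `B` generate `E`, and each element of either one can be moved into the
subalgebra `C` by adding an element of the other, then `C * A` is all of `E`. -/
theorem mul_eq_top_of_complementary {k E : Type*} [CommRing k] [Ring E] [Algebra k E]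
    (A B C : Subalgebra k E) (hgen : A ⊔ B = ⊤)
    (hA : ∀ a ∈ A, ∃ b ∈ B, a + b ∈ C) (hB : ∀ b ∈ B, ∃ a ∈ A, a + b ∈ C) :
    Subalgebra.toSubmodule C * Subalgebra.toSubmodule A = ⊤ := by
  set P := Subalgebra.toSubmodule C * Subalgebra.toSubmodule A with hP
  have hCA : ∀ c ∈ C, ∀ a ∈ A, c * a ∈ P := fun c hc a ha => Submodule.mul_mem_mul hc ha
  have hCP : ∀ c ∈ C, ∀ p ∈ P, c * p ∈ P := fun c hc p hp => by
    have h := Submodule.mul_mem_mul (M := Subalgebra.toSubmodule C) hc hp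
    rwa [hP, ← mul_assoc, C.isIdempotentElem_toSubmodule.eq] at h
  have hBP : ∀ b ∈ B, b ∈ P := fun b hb => by
    obtain ⟨a, ha, hab⟩ := hB b hb
    have h := P.sub_mem (hCA _ hab 1 A.one_mem) (hCA 1 C.one_mem a ha)
    simpa using h
  have hAB : ∀ a ∈ A, ∀ b ∈ B, a * b ∈ P := fun a ha b hb => by
    obtain ⟨b', hb', hc⟩ := hA a ha
    have h := P.sub_mem (hCP _ hc b (hBP b hb)) (hBP _ (B.mul_mem hb' hb))
    rwa [add_mul, add_sub_cancel_right] at h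
  let S : Subalgebra k E :=
    { carrier := {x | ∀ p ∈ P, p * x ∈ P}
      mul_mem' := fun {x y} hx hy p hp => by
        rw [← mul_assoc]
        exact hy _ (hx p hp)
      add_mem' := fun {x y} hx hy p hp => by
        rw [mul_add]
        exact P.add_mem (hx p hp) (hy p hp)
      algebraMap_mem' := fun r p hp => by
        rw [← Algebra.commutes, ← Algebra.smul_def]
        exact P.smul_mem r hp }
  have hS : ⊤ ≤ S := by
    rw [← hgen]
    refine sup_le (fun x hx p hp => ?_) (fun x hx p hp => ?_)
    · refine Submodule.mul_induction_on hp (fun c hc a ha => ?_) (fun u v hu hv => ?_)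
      · rw [mul_assoc]
        exact hCA c hc _ (A.mul_mem ha hx)
      · rw [add_mul]
        exact P.add_mem hu hv
    · refine Submodule.mul_induction_on hp (fun c hc a ha => ?_) (fun u v hu hv => ?_)
      · rw [mul_assoc]
        exact hCP c hc _ (hAB a ha x hx)
      · rw [add_mul]
        exact P.add_mem hu hv
  refine eq_top_iff.2 fun x _ => ?_
  have h := hS (Algebra.mem_top (x := x)) (1 * 1) (hCA 1 C.one_mem 1 A.one_mem)
  simpa using h

/-- A nonzero finitely generated module over a commutative algebra of finite type over an
algebraically closed field has a nonzero linear functional that is an eigenvector. -/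
theorem exists_eigenfunctional {k C N : Type*} [Field k] [IsAlgClosed k] [CommRing C]
    [Algebra k C] [Algebra.FiniteType k C] [AddCommGroup N] [Module C N] [Module k N]
    [IsScalarTower k C N] [Module.Finite C N] [Nontrivial N] :
    ∃ (χ : C →ₐ[k] k) (f : N →ₗ[k] k), f ≠ 0 ∧ ∀ c n, f (c • n) = χ c * f n := by
  obtain ⟨K, hK, -⟩ := (eq_top_or_exists_le_coatom (⊥ : Submodule C N)).resolve_left bot_ne_top
  have hs : IsSimpleModule C (N ⧸ K) := isSimpleModule_iff_isCoatom.2 hK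
  obtain ⟨I, hI, ⟨e⟩⟩ := isSimpleModule_iff_quot_maximal.1 hs
  let := Ideal.Quotient.field I
  have hfin : Module.Finite k (C ⧸ I) := finite_of_finite_type_of_isJacobsonRing k (C ⧸ I)
  let ε : k ≃ₐ[k] (C ⧸ I) := AlgEquiv.ofBijective (Algebra.ofId k (C ⧸ I))
    IsAlgClosed.algebraMap_bijective_of_isIntegral
  let g : N →ₗ[C] (C ⧸ I) := e.toLinearMap ∘ₗ K.mkQ
  have hg : Function.Surjective g := e.surjective.comp K.mkQ_surjective
  refine ⟨ε.symm.toAlgHom.comp (Ideal.Quotient.mkₐ k I),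
    ε.symm.toLinearMap ∘ₗ g.restrictScalars k, fun h => ?_, fun c n => ?_⟩
  · obtain ⟨n, hn⟩ := hg 1
    have h1 := LinearMap.congr_fun h n
    simp [hn] at h1
  · have h1 : g (c • n) = Ideal.Quotient.mk I c * g n := by
      rw [map_smul, Algebra.smul_def]
      rfl
    simp [h1]

/-- If an algebra `E` is the product of a commutative subalgebra `C` of finite type and
a finite-dimensional subspace `D`, then simple `E`-modules have dimension at most `dim D`. -/
theorem IsSimpleModule.finite_and_finrank_le {k E M : Type*} [Field k] [IsAlgClosed k]
    [Ring E] [Algebra k E] (C : Subalgebra k E) [IsMulCommutative C] [Algebra.FiniteType k C]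
    (D : Submodule k E) [FiniteDimensional k D]
    (hspan : Subalgebra.toSubmodule C * D = ⊤)
    [AddCommGroup M] [Module E M] [Module k M] [IsScalarTower k E M] [IsSimpleModule E M] :
    Module.Finite k M ∧ Module.finrank k M ≤ Module.finrank k D := by
  have : Nontrivial M := IsSimpleModule.nontrivial E M
  obtain ⟨m, hm⟩ := exists_ne (0 : M)
  obtain ⟨s, hs⟩ := (Submodule.fg_iff_finiteDimensional D).2 inferInstance
  have hfin : Module.Finite C M := by
    classical
    let T : Submodule C M := Submodule.span C ((fun d : E => d • m) '' (s : Set E))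
    have hD : ∀ d ∈ D, d • m ∈ T := fun d hd => by
      rw [← hs] at hd
      induction hd using Submodule.span_induction with
      | mem x hx => exact Submodule.subset_span ⟨x, hx, rfl⟩
      | zero => simp
      | add x y _ _ hx hy =>
        rw [add_smul]
        exact T.add_mem hx hy
      | smul r x _ hx =>
        rw [smul_assoc, ← algebraMap_smul C r]
        exact T.smul_mem _ hx
    have hE : ∀ q : E, q • m ∈ T := fun q => by
      have hq : q ∈ Subalgebra.toSubmodule C * D := hspan ▸ Submodule.mem_top
      refine Submodule.mul_induction_on hq ?_ (fun u v hu hv => ?_)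
      · intro c hc d hd
        rw [mul_smul]
        exact T.smul_mem (⟨c, hc⟩ : C) (hD d hd)
      · rw [add_smul]
        exact T.add_mem hu hv
    refine ⟨⟨s.image (fun d : E => d • m), ?_⟩⟩
    rw [Finset.coe_image]
    refine eq_top_iff.2 fun x _ => ?_
    obtain ⟨q, rfl⟩ := IsSimpleModule.toSpanSingleton_surjective E hm x
    exact hE q
  let : CommRing C := { (inferInstance : Ring C) with mul_comm := IsMulCommutative.is_comm.comm }
  obtain ⟨χ, f, hf, hχ⟩ := exists_eigenfunctional (k := k) (C := C) (N := M)
  let L : M →ₗ[k] (D →ₗ[k] k) :=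
    LinearMap.mk₂ k (fun x d => f ((d : E) • x))
      (by simp) (by simp [smul_algebra_smul_comm]) (by simp [add_smul]) (by simp)
  have hL : Function.Injective L := by
    rw [← LinearMap.ker_eq_bot, LinearMap.ker_eq_bot']
    intro x hx
    by_contra hx0
    refine hf (LinearMap.ext fun y => ?_)
    obtain ⟨q, rfl⟩ := IsSimpleModule.toSpanSingleton_surjective E hx0 y
    have hq : q ∈ Subalgebra.toSubmodule C * D := hspan ▸ Submodule.mem_top
    change f (q • x) = 0
    refine Submodule.mul_induction_on hq ?_ (fun u v hu hv => ?_)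
    · intro c hc d hd
      have h0 : f (d • x) = 0 := LinearMap.congr_fun hx ⟨d, hd⟩
      have h1 := hχ ⟨c, hc⟩ (d • x)
      rw [h0, mul_zero] at h1
      rw [mul_smul]
      exact h1
    · rw [add_smul, map_add, hu, hv, add_zero]
  exact ⟨Module.Finite.of_injective L hL,
    (LinearMap.finrank_le_finrank_of_injective hL).trans_eq Subspace.dual_finrank_eq⟩

/-- The two factors generate the free product. -/
theorem range_inl_sup_range_inr (k A B : Type) [CommRing k] [Ring A] [Ring B]
    [Algebra k A] [Algebra k B] : (inl k A B).range ⊔ (inr k A B).range = ⊤ := by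
  set S := (inl k A B).range ⊔ (inr k A B).range with hS
  let maps : {i : Bool} → fam A B i →ₐ[k] S := fun {i} => match i with
    | true => (inl k A B).codRestrict S fun a => (le_sup_left : _ ≤ S) ⟨a, rfl⟩
    | false => (inr k A B).codRestrict S fun b => (le_sup_right : _ ≤ S) ⟨b, rfl⟩
  let g : FP k A B →ₐ[k] S := LinearAlgebra.FreeProduct.lift k (fam A B) maps
  have hmaps : ∀ i, (S.val.comp g).comp (LinearAlgebra.FreeProduct.ι k (fam A B) i) =
      LinearAlgebra.FreeProduct.ι k (fam A B) i := fun i => by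
    rw [AlgHom.comp_assoc, LinearAlgebra.FreeProduct.lift_comp_ι]
    cases i <;> rfl
  have hid : S.val.comp g = AlgHom.id k (FP k A B) :=
    (LinearAlgebra.FreeProduct.lift k (fam A B)).symm.injective (by
      funext i
      exact hmaps i)
  refine eq_top_iff.2 fun x _ => ?_
  have h := AlgHom.congr_fun hid x
  rw [← AlgHom.id_apply (R := k) x, ← h]
  exact (g x).2

/-- Elements of `X` can be moved into a subalgebra by adding an element of `B` as soon as this
holds for the elements of a complement of the scalars. -/
theorem exists_add_mem_of_isCompl {k X E : Type*} [CommRing k] [Ring X] [Ring E] [Algebra k X]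
    [Algebra k E] (i : X →ₐ[k] E) (B C : Subalgebra k E) (Xbar : Submodule k X)
    (hX : IsCompl (Submodule.span k {(1 : X)}) Xbar)
    (h : ∀ x ∈ Xbar, ∃ b ∈ B, i x + b ∈ C) : ∀ a ∈ i.range, ∃ b ∈ B, a + b ∈ C := by
  rintro _ ⟨x, rfl⟩
  have hx : x ∈ Submodule.span k {(1 : X)} ⊔ Xbar := hX.sup_eq_top ▸ Submodule.mem_top
  obtain ⟨u, hu, y, hy, rfl⟩ := Submodule.mem_sup.1 hx
  obtain ⟨r, rfl⟩ := Submodule.mem_span_singleton.1 hu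
  obtain ⟨b, hb, hc⟩ := h y hy
  refine ⟨b, hb, ?_⟩
  have h1 := C.add_mem (C.smul_mem C.one_mem r) hc
  simpa [add_assoc] using h1

/-- Let `E` be generated by the images of `A` and `B`, and let `W` be a set of commuting sums of
elements of these images that surjects onto complements of the scalars in both `A` and `B`. Then
simple `E`-modules have dimension at most `min (dim A) (dim B)`. -/
theorem finite_and_finrank_le_min_of_commuting {k A B E M : Type*} [Field k] [IsAlgClosed k]
    [Ring A] [Ring B] [Ring E] [Algebra k A] [Algebra k B] [Algebra k E]
    [FiniteDimensional k A] [FiniteDimensional k B] (i : A →ₐ[k] E) (j : B →ₐ[k] E)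
    (hgen : i.range ⊔ j.range = ⊤) (Abar : Submodule k A) (Bbar : Submodule k B)
    (hAbar : IsCompl (Submodule.span k {(1 : A)}) Abar)
    (hBbar : IsCompl (Submodule.span k {(1 : B)}) Bbar)
    (W : Set E) (hW : ∀ w ∈ W, ∃ a b, w = i a + j b) (hcomm : ∀ x ∈ W, ∀ y ∈ W, x * y = y * x)
    (hsurjA : ∀ a ∈ Abar, ∃ b, i a + j b ∈ W) (hsurjB : ∀ b ∈ Bbar, ∃ a, i a + j b ∈ W)
    [AddCommGroup M] [Module E M] [Module k M] [IsScalarTower k E M] [IsSimpleModule E M] :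
    Module.Finite k M ∧
      Module.finrank k M ≤ min (Module.finrank k A) (Module.finrank k B) := by
  set C := Algebra.adjoin k W
  have : IsMulCommutative C := Algebra.isMulCommutative_adjoin k hcomm
  have hft : Algebra.FiniteType k C := by
    have hle : Submodule.span k W ≤ i.toLinearMap.range ⊔ j.toLinearMap.range :=
      Submodule.span_le.2 fun w hw => by
        obtain ⟨a, b, rfl⟩ := hW w hw
        exact Submodule.add_mem_sup ⟨a, rfl⟩ ⟨b, rfl⟩
    have := Submodule.finiteDimensional_of_le hle
    obtain ⟨s, hs⟩ := (Submodule.fg_iff_finiteDimensional (Submodule.span k W)).2 this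
    refine (Subalgebra.fg_iff_finiteType C).1 ⟨s, ?_⟩
    rw [← Algebra.adjoin_span, hs, Algebra.adjoin_span]
  have hA : ∀ a ∈ i.range, ∃ b ∈ j.range, a + b ∈ C :=
    exists_add_mem_of_isCompl i _ _ Abar hAbar fun a ha => by
      obtain ⟨b, hb⟩ := hsurjA a ha
      exact ⟨j b, ⟨b, rfl⟩, Algebra.subset_adjoin hb⟩
  have hB : ∀ b ∈ j.range, ∃ a ∈ i.range, b + a ∈ C :=
    exists_add_mem_of_isCompl j _ _ Bbar hBbar fun b hb => by
      obtain ⟨a, ha⟩ := hsurjB b hb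
      exact ⟨i a, ⟨a, rfl⟩, Algebra.subset_adjoin (by rwa [add_comm])⟩
  have hspanA := mul_eq_top_of_complementary i.range j.range C hgen hA
    (by simpa only [add_comm] using hB)
  have hspanB := mul_eq_top_of_complementary j.range i.range C (by rwa [sup_comm]) hB
    (by simpa only [add_comm] using hA)
  have : FiniteDimensional k (Subalgebra.toSubmodule i.range) :=
    inferInstanceAs (FiniteDimensional k i.toLinearMap.range)
  have : FiniteDimensional k (Subalgebra.toSubmodule j.range) :=
    inferInstanceAs (FiniteDimensional k j.toLinearMap.range)
  have h1 := IsSimpleModule.finite_and_finrank_le (M := M) C _ hspanA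
  have h2 := IsSimpleModule.finite_and_finrank_le (M := M) C _ hspanB
  exact ⟨h1.1, le_min (h1.2.trans i.toLinearMap.finrank_range_le)
    (h2.2.trans j.toLinearMap.finrank_range_le)⟩

theorem statement16 (k : Type) [Field k] [IsAlgClosed k] [CharZero k]
    (A B : Type) [Ring A] [Ring B] [Algebra k A] [Algebra k B]
    [FiniteDimensional k A] [FiniteDimensional k B]
    (Abar : Submodule k A) (Bbar : Submodule k B)
    (hAbar : IsCompl (Submodule.span k {(1 : A)}) Abar)
    (hBbar : IsCompl (Submodule.span k {(1 : B)}) Bbar)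
    (V : Submodule k (FP k A B))
    (hV : ∀ v ∈ V, ∃ a ∈ Abar, ∃ b ∈ Bbar, v = inl k A B a + inr k A B b)
    (hsurjA : ∀ a ∈ Abar, ∃ b ∈ Bbar, inl k A B a + inr k A B b ∈ V)
    (hsurjB : ∀ b ∈ Bbar, ∃ a ∈ Abar, inl k A B a + inr k A B b ∈ V) :
    -- every simple left module over `(A*B)/⟨[R(V),R(V)]⟩` has finite `k`-dimension
    -- at most `m = min (dim A) (dim B)`
    ∀ (M : Type) [AddCommGroup M]
      [Module (RingQuot (commRel k (FP k A B) (V : Set (FP k A B)))) M] [Module k M]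
      [IsScalarTower k (RingQuot (commRel k (FP k A B) (V : Set (FP k A B)))) M],
      IsSimpleModule (RingQuot (commRel k (FP k A B) (V : Set (FP k A B)))) M →
        Module.Finite k M ∧
        Module.finrank k M ≤ min (Module.finrank k A) (Module.finrank k B) := by
  intro M _ _ _ _ hM
  let π := RingQuot.mkAlgHom k (commRel k (FP k A B) (V : Set (FP k A B)))
  have hgen : (π.comp (inl k A B)).range ⊔ (π.comp (inr k A B)).range = ⊤ := by
    rw [AlgHom.range_comp, AlgHom.range_comp, ← Algebra.map_sup, range_inl_sup_range_inr,
      Algebra.map_top]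
    exact (AlgHom.range_eq_top π).2 (RingQuot.mkAlgHom_surjective k _)
  refine finite_and_finrank_le_min_of_commuting _ _ hgen Abar Bbar hAbar hBbar
    (π '' V) ?_ ?_ (fun a ha => ?_) (fun b hb => ?_)
  · rintro _ ⟨v, hv, rfl⟩
    obtain ⟨a, -, b, -, rfl⟩ := hV v hv
    exact ⟨a, b, map_add π _ _⟩
  · rintro _ ⟨v, hv, rfl⟩ _ ⟨w, hw, rfl⟩
    have h : π (v * w - w * v) = π 0 := RingQuot.mkAlgHom_rel k
      ⟨⟨v, Algebra.subset_adjoin hv, w, Algebra.subset_adjoin hw, rfl⟩, rfl⟩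
    rwa [map_sub, map_mul, map_mul, map_zero, sub_eq_zero] at h
  · obtain ⟨b, -, hb⟩ := hsurjA a ha
    exact ⟨b, _, hb, map_add π _ _⟩
  · obtain ⟨a, -, ha⟩ := hsurjB b hb
    exact ⟨a, _, ha, map_add π _ _⟩
end
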